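/- Let k be a positive integer. If X is an S(3k)-space, then |X| ≤ 2^{2^{s_{2k}(X)}}; if X is an S(3k-2)-space, then |X| ≤ 2^{2^{s_{2k-1}(X)}}; and if X is an S(3k-1)-space, then |X| ≤ 2^{s_{2k-1}(X)·2^{s_{2k}(X)}} and |X| ≤ 2^{2^{s_{2k-1}(X)}}. -/

import Mathlib

open Cardinal Set

universe u

variable {X : Type u}

/-- `x` is S(n)-separated from `A`. -/
def SSep [TopologicalSpace X] : ℕ → X → Set X → Prop
  | 0, x, A => x ∉ closure A
  | (n+1), x, A => ∃ U : ℕ → Set X, (∀ i ≤ n, IsOpen (U i)) ∧ x ∈ U 0 ∧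
      (∀ i < n, closure (U i) ⊆ U (i+1)) ∧ closure (U n) ∩ A = ∅

/-- `X` is an S(n)-space. -/
def SSpace (n : ℕ) (X : Type u) [TopologicalSpace X] : Prop :=
  ∀ x y : X, x ≠ y → SSep n x {y}

/-- `U` is an S(2k-1)-neighborhood of `x` (for `k ≥ 1`). -/
def SOddNhd [TopologicalSpace X] (k : ℕ) (x : X) (U : Set X) : Prop :=
  ∃ V : ℕ → Set X, (∀ i < k, IsOpen (V i)) ∧ x ∈ V 0 ∧
    (∀ i, i + 1 < k → closure (V i) ⊆ V (i+1)) ∧ V (k-1) ⊆ U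

/-- `U` is an S(2k)-neighborhood of `x` (for `k ≥ 1`). -/
def SEvenNhd [TopologicalSpace X] (k : ℕ) (x : X) (U : Set X) : Prop :=
  ∃ V : ℕ → Set X, (∀ i < k, IsOpen (V i)) ∧ x ∈ V 0 ∧
    (∀ i, i + 1 < k → closure (V i) ⊆ V (i+1)) ∧ closure (V (k-1)) ⊆ U

/-- `U` is an open S(2k-1)-neighborhood of `x`. -/
def SOpenNhd [TopologicalSpace X] (k : ℕ) (x : X) (U : Set X) : Prop :=
  IsOpen U ∧ SOddNhd k x U

/-- `U` is an S(2k-1)-open set. -/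
def SOpen [TopologicalSpace X] (k : ℕ) (U : Set X) : Prop :=
  IsOpen U ∧ ∃ x, SOddNhd k x U

/-- The S(2k-1)-closure `θ_{2k-1}(A)`. -/
def thetaOdd [TopologicalSpace X] (k : ℕ) (A : Set X) : Set X :=
  {x | ∀ U : Set X, SOpenNhd k x U → (U ∩ A).Nonempty}

/-- The S(2k)-closure `θ_{2k}(A)`. -/
def thetaEven [TopologicalSpace X] (k : ℕ) (A : Set X) : Set X :=
  {x | ∀ U : Set X, SOpenNhd k x U → (closure U ∩ A).Nonempty}

/-- `D` is S(2k-1)-discrete. -/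
def SOddDiscrete [TopologicalSpace X] (k : ℕ) (D : Set X) : Prop :=
  ∀ x ∈ D, ∃ U : Set X, SOpenNhd k x U ∧ U ∩ D = {x}

/-- `D` is S(2k)-discrete. -/
def SEvenDiscrete [TopologicalSpace X] (k : ℕ) (D : Set X) : Prop :=
  ∀ x ∈ D, ∃ U : Set X, SOpenNhd k x U ∧ closure U ∩ D = {x}

/-- The S(2k-1)-spread `s_{2k-1}(X)`. -/
noncomputable def spreadOdd (k : ℕ) (X : Type u) [TopologicalSpace X] : Cardinal :=
  (⨆ D : {D : Set X // SOddDiscrete k D}, #D.1) ⊔ Cardinal.aleph0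

/-- The S(2k)-spread `s_{2k}(X)`. -/
noncomputable def spreadEven (k : ℕ) (X : Type u) [TopologicalSpace X] : Cardinal :=
  (⨆ D : {D : Set X // SEvenDiscrete k D}, #D.1) ⊔ Cardinal.aleph0

/-- The S(2k-1)-cellularity `c_{2k-1}(X)`. -/
noncomputable def cellOdd (k : ℕ) (X : Type u) [TopologicalSpace X] : Cardinal :=
  (⨆ F : {F : Set (Set X) // (∀ U ∈ F, SOpen k U ∧ U.Nonempty) ∧
      (∀ U ∈ F, ∀ V ∈ F, U ≠ V → U ∩ V = ∅)}, #F.1) ⊔ Cardinal.aleph0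

/-- The S(2k)-cellularity `c_{2k}(X)`. -/
noncomputable def cellEven (k : ℕ) (X : Type u) [TopologicalSpace X] : Cardinal :=
  (⨆ F : {F : Set (Set X) // (∀ U ∈ F, SOpen k U ∧ U.Nonempty) ∧
      (∀ U ∈ F, ∀ V ∈ F, U ≠ V → closure U ∩ closure V = ∅)}, #F.1) ⊔ Cardinal.aleph0

/-- The S(2k-1)-character `χ_{2k-1}(X)`. -/
noncomputable def charOdd (k : ℕ) (X : Type u) [TopologicalSpace X] : Cardinal :=
  sInf {c | Cardinal.aleph0 ≤ c ∧ ∀ x : X, ∃ B : Set (Set X), #B ≤ c ∧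
    (∀ U ∈ B, SOpenNhd k x U) ∧
    ∀ U : Set X, SOpenNhd k x U → ∃ V ∈ B, V ⊆ U}

/-- The S(2k)-character `χ_{2k}(X)`. -/
noncomputable def charEven (k : ℕ) (X : Type u) [TopologicalSpace X] : Cardinal :=
  sInf {c | Cardinal.aleph0 ≤ c ∧ ∀ x : X, ∃ B : Set (Set X), #B ≤ c ∧
    (∀ V ∈ B, IsClosed V ∧ SOddNhd k x V) ∧
    ∀ W : Set X, SOpenNhd k x W → ∃ V ∈ B, V ⊆ closure W}

/-- The S(2k-1)-pseudocharacter `ψ_{2k-1}(X)`. -/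
noncomputable def psiOdd (k : ℕ) (X : Type u) [TopologicalSpace X] : Cardinal :=
  sInf {c | Cardinal.aleph0 ≤ c ∧ ∀ x : X, ∃ B : Set (Set X), #B ≤ c ∧
    (∀ U ∈ B, SOpenNhd k x U) ∧ ⋂₀ B = {x}}

/-- The S(2k)-pseudocharacter `ψ_{2k}(X)`. -/
noncomputable def psiEven (k : ℕ) (X : Type u) [TopologicalSpace X] : Cardinal :=
  sInf {c | Cardinal.aleph0 ≤ c ∧ ∀ x : X, ∃ B : Set (Set X), #B ≤ c ∧
    (∀ U ∈ B, SOpenNhd k x U) ∧ (⋂ U ∈ B, closure U) = {x}}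

/-- The usual pseudocharacter `ψ(X)`. -/
noncomputable def psi (X : Type u) [TopologicalSpace X] : Cardinal :=
  sInf {c | Cardinal.aleph0 ≤ c ∧ ∀ x : X, ∃ B : Set (Set X), #B ≤ c ∧
    (∀ U ∈ B, IsOpen U) ∧ ⋂₀ B = {x}}

theorem endhom {X W K : Type u} [LinearOrder X] [WellFoundedLT X] [LinearOrder W]
    [WellFoundedLT W] (l : Cardinal.{u}) (hl : ℵ₀ ≤ l) (hW : #W ≤ 2 ^ l)
    (hI : ∀ w : W, #(Set.Iio w) ≤ l) (hK : #K ≤ 2 ^ l) (hX : 2 ^ l < #X)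
    (c : X → X → X → K) :
    ∃ (f : W → X) (p : X), StrictMono f ∧
      ∀ a b i, a < i → b < i → c (f a) (f b) (f i) = c (f a) (f b) p := by
  classical
  have hne : Nonempty X := by
    rw [← Cardinal.mk_ne_zero_iff]
    exact (lt_of_le_of_lt bot_le hX).ne_bot
  obtain ⟨m, hm1, hm2⟩ : ∃ m : Set X → X, (∀ s : Set X, s.Nonempty → m s ∈ s) ∧
      ∀ s : Set X, ∀ x ∈ s, m s ≤ x := by
    refine ⟨fun s => if h : s.Nonempty then (wellFounded_lt (α := X)).min s h
      else Classical.choice hne, ?_, ?_⟩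
    · intro s h
      simp only [h, dite_true]
      exact WellFounded.min_mem _ _ _
    · intro s x hx
      have h : s.Nonempty := ⟨x, hx⟩
      simp only [h, dite_true]
      exact not_lt.1 (WellFounded.not_lt_min _ _ hx)
  let S : X → W → (W → X) → Set X := fun p w f =>
    {q | (∀ v, v < w → q ≠ f v) ∧ ∀ a, a < w → ∀ b, b < w → c (f a) (f b) q = c (f a) (f b) p}
  have hF : ∀ p, ∃ f : W → X, ∀ w, f w = m (S p w f) := by
    intro p
    refine ⟨(wellFounded_lt (α := W)).fix (fun w g => m {q | (∀ v (h : v < w), q ≠ g v h) ∧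
      ∀ a (ha : a < w), ∀ b (hb : b < w), c (g a ha) (g b hb) q = c (g a ha) (g b hb) p}), ?_⟩
    intro w
    rw [WellFounded.fix_eq]
  choose F hF using hF
  by_cases hp : ∃ p, ∀ w, F p w ≠ p
  · obtain ⟨p, hp⟩ := hp
    have hS : ∀ w, F p w ∈ S p w (F p) := by
      intro w
      have : (S p w (F p)).Nonempty := ⟨p, fun v _ h => hp v h.symm, fun _ _ _ _ => rfl⟩
      have h := hm1 _ this
      rwa [← hF p w] at h
    refine ⟨F p, p, ?_, fun a b i ha hb => (hS i).2 a ha b hb⟩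
    intro v w hvw
    have h1 : F p w ∈ S p v (F p) :=
      ⟨fun u hu => (hS w).1 u (hu.trans hvw),
        fun a ha b hb => (hS w).2 a (ha.trans hvw) b (hb.trans hvw)⟩
    have h2 := hm2 _ _ h1
    rw [← hF p v] at h2
    exact lt_of_le_of_ne h2 ((hS w).1 v hvw).symm
  · push Not at hp
    choose t ht using hp
    exfalso
    let code : X → (Σ w : W, (Set.Iio w × Set.Iio w → K)) := fun p =>
      ⟨t p, fun ab => c (F p ab.1) (F p ab.2) p⟩
    let dec : (Σ w : W, (Set.Iio w × Set.Iio w → K)) → W → W → Option K := fun s a b =>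
      if h : a < s.1 ∧ b < s.1 then some (s.2 (⟨a, h.1⟩, ⟨b, h.2⟩)) else none
    have hinj : Function.Injective code := by
      intro p q hpq
      have h1 : t p = t q := congrArg Sigma.fst hpq
      have h2 : ∀ a b, a < t p → b < t p → c (F p a) (F p b) p = c (F q a) (F q b) q := by
        intro a b ha hb
        have h := congrFun (congrFun (congrArg dec hpq) a) b
        have ha' : a < t q := h1 ▸ ha
        have hb' : b < t q := h1 ▸ hb
        simpa [dec, code, ha, hb, ha', hb'] using h
      have h3 : ∀ v, v ≤ t p → F p v = F q v := by
        intro v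
        induction v using WellFoundedLT.induction with
        | ind v ih =>
          intro hv
          rw [hF p v, hF q v]
          congr 1
          have ih' : ∀ a, a < v → F p a = F q a := fun a ha => ih a ha (ha.le.trans hv)
          ext r
          constructor
          · rintro ⟨r1, r2⟩
            refine ⟨fun a ha => ih' a ha ▸ r1 a ha, fun a ha b hb => ?_⟩
            rw [← h2 a b (ha.trans_le hv) (hb.trans_le hv), ← ih' a ha, ← ih' b hb]
            exact r2 a ha b hb
          · rintro ⟨r1, r2⟩
            refine ⟨fun a ha => ih' a ha ▸ r1 a ha, fun a ha b hb => ?_⟩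
            rw [h2 a b (ha.trans_le hv) (hb.trans_le hv), ih' a ha, ih' b hb]
            exact r2 a ha b hb
      have h4 := h3 (t p) le_rfl
      rw [ht p, h1, ht q] at h4
      exact h4
    have hcard := Cardinal.mk_le_of_injective hinj
    refine absurd hX (not_lt.2 (hcard.trans ?_))
    rw [Cardinal.mk_sigma]
    have hl2 : ℵ₀ ≤ (2 : Cardinal.{u}) ^ l := hl.trans (Cardinal.cantor l).le
    calc Cardinal.sum (fun w : W => #(Set.Iio w × Set.Iio w → K))
        ≤ Cardinal.sum (fun _ : W => (2 : Cardinal.{u}) ^ l) := by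
          apply Cardinal.sum_le_sum
          intro w
          rw [← Cardinal.power_def, Cardinal.mk_prod, Cardinal.lift_id]
          have : #(Set.Iio w) * #(Set.Iio w) ≤ l :=
            (mul_le_mul' (hI w) (hI w)).trans (Cardinal.mul_eq_self hl).le
          calc #K ^ (#(Set.Iio w) * #(Set.Iio w)) ≤ (2 ^ l) ^ (#(Set.Iio w) * #(Set.Iio w)) :=
                Cardinal.power_le_power_right hK
            _ ≤ (2 ^ l) ^ l := Cardinal.power_le_power_left
                (Cardinal.power_ne_zero _ two_ne_zero) this
            _ = 2 ^ l := by rw [← Cardinal.power_mul, Cardinal.mul_eq_self hl]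
      _ = #W * 2 ^ l := by simp
      _ ≤ 2 ^ l * 2 ^ l := mul_le_mul' hW le_rfl
      _ = 2 ^ l := Cardinal.mul_eq_self hl2

theorem comb {X : Type u} (κ : Cardinal.{u}) (hκ : ℵ₀ ≤ κ)
    (hX : (2 : Cardinal.{u}) ^ ((2 : Cardinal.{u}) ^ κ) < #X) (A B : X → X → Set X)
    (hA : ∀ x y, x ≠ y → x ∈ A x y) (hB : ∀ x y, x ≠ y → y ∈ B x y)
    (hAB : ∀ x y, x ≠ y → A x y ∩ B x y = ∅) :
    ∃ D : Set X, κ < #D ∧ ∀ y ∈ D, ∃ x z, x ≠ y ∧ y ≠ z ∧ (A y z ∩ B x y) ∩ D = {y} := by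
  classical
  have hl2 : ℵ₀ ≤ (2 : Cardinal.{u}) ^ κ := hκ.trans (Cardinal.cantor κ).le
  letI : LinearOrder X := linearOrderOfSTO WellOrderingRel
  haveI : WellFoundedLT X := ⟨IsWellFounded.wf (r := (WellOrderingRel : X → X → Prop))⟩
  let K := ULift.{u} (Prop × Prop)
  have hK : #K ≤ ℵ₀ := Cardinal.mk_le_aleph0
  let W1 := (Order.succ ((2 : Cardinal.{u}) ^ κ)).ord.ToType
  let W2 := (Order.succ κ).ord.ToType
  have hW1 : #W1 = Order.succ (2 ^ κ) := Cardinal.mk_ord_toType _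
  have hW2 : #W2 = Order.succ κ := Cardinal.mk_ord_toType _
  have hI1 : ∀ w : W1, #(Set.Iio w) ≤ 2 ^ κ := fun w =>
    Order.lt_succ_iff.1 (Cardinal.mk_Iio_toType_ord_lt w)
  have hI2 : ∀ w : W2, #(Set.Iio w) ≤ κ := fun w =>
    Order.lt_succ_iff.1 (Cardinal.mk_Iio_toType_ord_lt w)
  let c : X → X → X → K := fun x y z => ⟨(z ∈ A x y, x ∈ A y z)⟩
  obtain ⟨f, p, hf, hfp⟩ := endhom (W := W1) (2 ^ κ) hl2
    (hW1.le.trans (Order.succ_le_of_lt (Cardinal.cantor _))) hI1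
    (hK.trans (hl2.trans (Cardinal.cantor _).le)) hX c
  obtain ⟨g, q, hg, hgq⟩ := endhom (X := W1) (W := W2) κ hκ
    (hW2.le.trans (Order.succ_le_of_lt (Cardinal.cantor _))) hI2
    (hK.trans hl2) (by rw [hW1]; exact Order.lt_succ _) (fun a _ b => c (f a) (f b) p)
  let e : W2 → X := fun i => f (g i)
  have he : StrictMono e := hf.comp hg
  let h : W2 → K := fun i => c (e i) (f q) p
  have hom : ∀ i j k, i < j → j < k → c (e i) (e j) (e k) = h i := by
    intro i j k hij hjk
    have h1 := hfp (g i) (g j) (g k) (hg (hij.trans hjk)) (hg hjk)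
    have h2 := hgq i i j hij hij
    exact h1.trans h2
  -- pigeonhole
  have hpig : ∃ r : K, κ < #(h ⁻¹' {r}) := by
    by_contra hcon
    push Not at hcon
    have h1 : #W2 ≤ Cardinal.sum (fun r : K => #(h ⁻¹' {r})) := by
      rw [← Cardinal.mk_sigma]
      exact Cardinal.mk_le_of_injective (f := fun i => (⟨h i, ⟨i, rfl⟩⟩ : Σ r : K, h ⁻¹' {r}))
        (fun i j hij => by
          have := congrArg (fun s : (Σ r : K, h ⁻¹' {r}) => (s.2 : W2)) hij
          exact this)
    have h2 : Cardinal.sum (fun r : K => #(h ⁻¹' {r})) ≤ κ := by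
      calc _ ≤ Cardinal.sum (fun _ : K => κ) := Cardinal.sum_le_sum _ _ hcon
        _ = #K * κ := by simp
        _ ≤ κ * κ := mul_le_mul' (hK.trans hκ) le_rfl
        _ = κ := Cardinal.mul_eq_self hκ
    rw [hW2] at h1
    exact absurd (h1.trans h2) (not_le.2 (Order.lt_succ κ))
  obtain ⟨r, hr⟩ := hpig
  set H : Set W2 := h ⁻¹' {r} with hH
  have hsucc : ∀ i : W2, ∃ j ∈ H, i < j ∧ ∀ k ∈ H, i < k → j ≤ k := by
    intro i
    have hne : (H ∩ Set.Ioi i).Nonempty := by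
      by_contra hcon
      have hsub : H ⊆ Set.Iio i ∪ {i} := by
        intro j hj
        by_contra hj'
        apply hcon
        refine ⟨j, hj, ?_⟩
        simp only [Set.mem_union, Set.mem_Iio, Set.mem_singleton_iff, not_or, not_lt] at hj'
        exact lt_of_le_of_ne hj'.1 (Ne.symm hj'.2)
      have : #H ≤ κ := (Cardinal.mk_le_mk_of_subset hsub).trans
        ((Cardinal.mk_union_le _ _).trans
          ((add_le_add (hI2 i) (by simpa using Cardinal.one_le_aleph0.trans hκ)).trans
            (Cardinal.add_eq_self hκ).le))
      exact absurd hr (not_lt.2 this)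
    refine ⟨(wellFounded_lt (α := W2)).min _ hne, (WellFounded.min_mem _ _ hne).1,
      (WellFounded.min_mem _ _ hne).2, fun k hk hik => ?_⟩
    have hmem : k ∈ H ∩ Set.Ioi i := ⟨hk, hik⟩
    exact not_lt.1 (WellFounded.not_lt_min _ _ hmem)
  choose s hsH hs1 hs2 using hsucc
  refine ⟨(fun i : W2 => e (s i)) '' H, ?_, ?_⟩
  · rw [Cardinal.mk_image_eq_of_injOn]
    · exact hr
    · intro i hi j hj hij
      have hij : s i = s j := he.injective hij
      rcases lt_trichotomy i j with h1 | h1 | h1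
      · exact absurd (hs2 i j hj h1) (not_le.2 (hij ▸ hs1 j))
      · exact h1
      · exact absurd (hs2 j i hi h1) (not_le.2 (hij ▸ hs1 i))
  · rintro _ ⟨i, hi, rfl⟩
    -- i < y = s i < z = s (s i)
    set y := s i with hy
    have hiy : i < y := hs1 i
    have hyz : y < s y := hs1 y
    have nxy := (he hiy).ne
    have nyz := (he hyz).ne
    have hyH : y ∈ H := hsH i
    refine ⟨e i, e (s y), nxy, nyz, ?_⟩
    have key : ∀ a ∈ H, ∀ b d, a < b → b < d →
        ((e d ∈ A (e a) (e b)) ↔ r.down.1) ∧ ((e a ∈ A (e b) (e d)) ↔ r.down.2) := by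
      intro a ha b d hab hbd
      have h1 : c (e a) (e b) (e d) = r := (hom a b d hab hbd).trans ha
      rw [← h1]
      exact ⟨Iff.rfl, Iff.rfl⟩
    have dis : ∀ a b d, a < b → e d ∈ A (e a) (e b) → e d ∈ B (e a) (e b) → False := by
      intro a b d hab h1 h2
      have h3 : e d ∈ A (e a) (e b) ∩ B (e a) (e b) := ⟨h1, h2⟩
      rw [hAB _ _ (he hab).ne] at h3
      exact h3
    apply Set.Subset.antisymm
    · rintro _ ⟨⟨hwA, hwB⟩, ⟨j, hj, rfl⟩⟩
      simp only at hwA hwB ⊢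
      have hkH : s j ∈ H := hsH j
      generalize s j = w at *
      rw [Set.mem_singleton_iff]
      rcases lt_trichotomy w y with h1 | h1 | h1
      · exfalso
        have hwi : w ≤ i := by
          by_contra hcon
          exact absurd (hs2 i w hkH (not_le.1 hcon)) (not_le.2 h1)
        rcases hwi.eq_or_lt with h2 | h2
        · subst h2
          exact dis _ _ _ h1 (hA _ _ nxy) hwB
        · have k1 := (key w hkH y (s y) h1 hyz).2.1 hwA
          have k2 := (key w hkH i y h2 hiy).2.2 k1
          exact dis _ _ _ hiy k2 hwB
      · rw [h1]
      · exfalso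
        have hwi : s y ≤ w := hs2 y w hkH h1
        rcases hwi.eq_or_lt with h2 | h2
        · rw [← h2] at hwA
          exact dis _ _ _ hyz hwA (hB _ _ nyz)
        · have k1 := (key y hyH (s y) w hyz h2).1.1 hwA
          have k2 := (key i hi y w hiy h1).1.2 k1
          exact dis _ _ _ hiy k2 hwB
    · rintro _ rfl
      exact ⟨⟨hA _ _ nyz, hB _ _ nxy⟩, ⟨i, hi, rfl⟩⟩

theorem sep_aux [TopologicalSpace X] (k m : ℕ) (hk : 1 ≤ k) (hm : 2 * k - 1 ≤ m + 1)
    (x y : X) (h : SSep (m + 1) x {y}) :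
    ∃ A B : Set X, SOpenNhd k x A ∧ SOpenNhd k y B ∧ A ∩ B = ∅ ∧
      (2 * k ≤ m + 1 → closure A ∩ closure B = ∅) := by
  obtain ⟨U, hU, hx, hc, hy⟩ := h
  have mono : ∀ i j, i ≤ j → j ≤ m → U i ⊆ U j := by
    intro i j hij
    induction j, hij using Nat.le_induction with
    | base => exact fun _ => le_rfl
    | succ j hij ih =>
      intro hj
      exact (ih (by omega)).trans (subset_closure.trans (hc j (by omega)))
  have hclB : ∀ j, j ≤ m → closure (closure (U j))ᶜ ⊆ (U j)ᶜ := by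
    intro j hj
    rw [closure_compl]
    exact Set.compl_subset_compl.2 (interior_maximal subset_closure (hU j hj))
  refine ⟨U (k - 1), (closure (U (m - (k - 1))))ᶜ, ⟨hU _ (by omega), U, fun i hi => hU i (by omega),
    hx, fun i hi => hc i (by omega), le_rfl⟩, ⟨isClosed_closure.isOpen_compl,
    fun j => (closure (U (m - j)))ᶜ, fun i _ => isClosed_closure.isOpen_compl, ?_, ?_, le_rfl⟩, ?_, ?_⟩
  · intro hy'
    have : y ∈ closure (U m) ∩ {y} := ⟨hy', rfl⟩
    rw [hy] at this
    exact this
  · intro i hi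
    refine (hclB _ (by omega)).trans (Set.compl_subset_compl.2 ?_)
    have := hc (m - (i + 1)) (by omega)
    rwa [show m - (i + 1) + 1 = m - i by omega] at this
  · ext z
    simp only [Set.mem_inter_iff, Set.mem_compl_iff, Set.mem_empty_iff_false, iff_false, not_and,
      not_not]
    exact fun hz => subset_closure (mono _ _ (by omega) (by omega) hz)
  · intro hm2
    ext z
    simp only [Set.mem_inter_iff, Set.mem_empty_iff_false, iff_false, not_and]
    intro hz hz2
    exact hclB _ (by omega) hz2 (mono (k - 1 + 1) _ (by omega) (by omega) (hc _ (by omega) hz))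

theorem SOpenNhd.inter' [TopologicalSpace X] {k : ℕ} {x : X} {A B : Set X}
    (hA : SOpenNhd k x A) (hB : SOpenNhd k x B) : SOpenNhd k x (A ∩ B) := by
  obtain ⟨oA, V, hV, xV, cV, sV⟩ := hA
  obtain ⟨oB, W, hW, xW, cW, sW⟩ := hB
  exact ⟨oA.inter oB, fun i => V i ∩ W i, fun i hi => (hV i hi).inter (hW i hi), ⟨xV, xW⟩,
    fun i hi => (closure_inter_subset_inter_closure _ _).trans
      (Set.inter_subset_inter (cV i hi) (cW i hi)), Set.inter_subset_inter sV sW⟩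

theorem SOpenNhd.mem' [TopologicalSpace X] {k : ℕ} (hk : 1 ≤ k) {x : X} {A : Set X}
    (hA : SOpenNhd k x A) : x ∈ A := by
  obtain ⟨oA, V, hV, xV, cV, sV⟩ := hA
  have : ∀ i, i < k → x ∈ V i := by
    intro i
    induction i with
    | zero => exact fun _ => xV
    | succ i ih => exact fun hi => cV i hi (subset_closure (ih (by omega)))
  exact sV (this _ (by omega))

theorem odd_bound (k m : ℕ) (hk : 1 ≤ k) (hm : 2 * k - 1 ≤ m + 1) (X : Type u)
    [TopologicalSpace X] (h : SSpace (m + 1) X) :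
    #X ≤ 2 ^ ((2 : Cardinal) ^ spreadOdd k X) := by
  classical
  by_contra hcon
  have hs : ∀ x y : X, ∃ A B : Set X, x ≠ y → SOpenNhd k x A ∧ SOpenNhd k y B ∧ A ∩ B = ∅ := by
    intro x y
    by_cases hxy : x = y
    · exact ⟨∅, ∅, fun h => absurd hxy h⟩
    · obtain ⟨A, B, h1, h2, h3, -⟩ := sep_aux k m hk hm x y (h x y hxy)
      exact ⟨A, B, fun _ => ⟨h1, h2, h3⟩⟩
  choose A B hAB using hs
  obtain ⟨D, hD, hD2⟩ := comb (spreadOdd k X) le_sup_right (not_le.1 hcon) A B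
    (fun x y hxy => (hAB x y hxy).1.mem' hk) (fun x y hxy => (hAB x y hxy).2.1.mem' hk)
    (fun x y hxy => (hAB x y hxy).2.2)
  have hdisc : SOddDiscrete k D := by
    intro y hy
    obtain ⟨x, z, hxy, hyz, hxyz⟩ := hD2 y hy
    exact ⟨_, (hAB y z hyz).1.inter' (hAB x y hxy).2.1, hxyz⟩
  have : #D ≤ spreadOdd k X :=
    (le_ciSup (f := fun D : {D : Set X // SOddDiscrete k D} => #D.1)
      (Cardinal.bddAbove_range _) ⟨D, hdisc⟩).trans le_sup_left
  exact absurd hD (not_lt.2 this)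

theorem even_bound (k m : ℕ) (hk : 1 ≤ k) (hm : 2 * k ≤ m + 1) (X : Type u)
    [TopologicalSpace X] (h : SSpace (m + 1) X) :
    #X ≤ 2 ^ ((2 : Cardinal) ^ spreadEven k X) := by
  classical
  by_contra hcon
  have hs : ∀ x y : X, ∃ A B : Set X, x ≠ y →
      SOpenNhd k x A ∧ SOpenNhd k y B ∧ closure A ∩ closure B = ∅ := by
    intro x y
    by_cases hxy : x = y
    · exact ⟨∅, ∅, fun h => absurd hxy h⟩
    · obtain ⟨A, B, h1, h2, -, h3⟩ := sep_aux k m hk (by omega) x y (h x y hxy)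
      exact ⟨A, B, fun _ => ⟨h1, h2, h3 hm⟩⟩
  choose A B hAB using hs
  obtain ⟨D, hD, hD2⟩ := comb (spreadEven k X) le_sup_right (not_le.1 hcon)
    (fun x y => closure (A x y)) (fun x y => closure (B x y))
    (fun x y hxy => subset_closure ((hAB x y hxy).1.mem' hk))
    (fun x y hxy => subset_closure ((hAB x y hxy).2.1.mem' hk))
    (fun x y hxy => (hAB x y hxy).2.2)
  have hdisc : SEvenDiscrete k D := by
    intro y hy
    obtain ⟨x, z, hxy, hyz, hxyz⟩ := hD2 y hy
    have hN := (hAB y z hyz).1.inter' (hAB x y hxy).2.1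
    refine ⟨_, hN, Set.Subset.antisymm ?_ ?_⟩
    · rw [← hxyz]
      exact Set.inter_subset_inter_left _ (closure_inter_subset_inter_closure _ _)
    · rintro _ rfl
      exact ⟨subset_closure (hN.mem' hk), hy⟩
  have : #D ≤ spreadEven k X :=
    (le_ciSup (f := fun D : {D : Set X // SEvenDiscrete k D} => #D.1)
      (Cardinal.bddAbove_range _) ⟨D, hdisc⟩).trans le_sup_left
  exact absurd hD (not_lt.2 this)

theorem stmt19 (k : ℕ) (hk : 1 ≤ k) (X : Type u) [TopologicalSpace X] :
    (SSpace (3 * k) X → #X ≤ 2 ^ ((2 : Cardinal) ^ spreadEven k X)) ∧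
    (SSpace (3 * k - 2) X → #X ≤ 2 ^ ((2 : Cardinal) ^ spreadOdd k X)) ∧
    (SSpace (3 * k - 1) X →
      #X ≤ 2 ^ (spreadOdd k X * (2 : Cardinal) ^ spreadEven k X) ∧ #X ≤ 2 ^ ((2 : Cardinal) ^ spreadOdd k X)) := by
  refine ⟨fun h => ?_, fun h => ?_, fun h => ⟨?_, ?_⟩⟩
  · rw [show 3 * k = (3 * k - 1) + 1 by omega] at h
    exact even_bound k _ hk (by omega) X h
  · rw [show 3 * k - 2 = (3 * k - 3) + 1 by omega] at h
    exact odd_bound k _ hk (by omega) X h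
  · rw [show 3 * k - 1 = (3 * k - 2) + 1 by omega] at h
    refine (even_bound k _ hk (by omega) X h).trans
      (Cardinal.power_le_power_left two_ne_zero ?_)
    have h1 : 1 ≤ spreadOdd k X := Cardinal.one_le_aleph0.trans le_sup_right
    calc (2 : Cardinal) ^ spreadEven k X = 1 * 2 ^ spreadEven k X := (one_mul _).symm
      _ ≤ _ := mul_le_mul' h1 le_rfl
  · rw [show 3 * k - 1 = (3 * k - 2) + 1 by omega] at h
    exact odd_bound k _ hk (by omega) X h
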